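/- Let n ≥ 2 and 1 ≤ k ≤ n. Define the linear map 𝐓 : ℝⁿ → ℝⁿ by Tᵢ(λ) := Σ_{j≠i} λⱼ, and set Γ := 𝐓⁻¹(Γ_k) = {λ ∈ ℝⁿ : 𝐓(λ) ∈ Γ_k}. Then Γ is an open convex cone with vertex at the origin, symmetric under permutations of coordinates, containing the positive orthant Γₙ; and the function f(λ) := log σ_k(𝐓(λ)) is smooth and concave on Γ with ∂f/∂λᵢ > 0 on Γ for every i = 1,…,n. -/

import Mathlib

/-- The `k`-th elementary symmetric polynomial `σ_k` on `ℝⁿ`. -/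
noncomputable def esymm (n k : ℕ) (x : Fin n → ℝ) : ℝ :=
  ∑ s ∈ Finset.powersetCard k (Finset.univ : Finset (Fin n)), ∏ i ∈ s, x i

/-- The standard `k`-positive cone `Γ_k = {x ∈ ℝⁿ : σ₁(x) > 0, …, σ_k(x) > 0}`. -/
def gammaCone (n k : ℕ) : Set (Fin n → ℝ) :=
  {x | ∀ j : ℕ, 1 ≤ j → j ≤ k → 0 < esymm n j x}

/-- The linear map `𝐓 : ℝⁿ → ℝⁿ`, `Tᵢ(λ) = Σ_{j≠i} λⱼ`. -/
def TT (n : ℕ) (x : Fin n → ℝ) : Fin n → ℝ := fun i => (∑ j, x j) - x i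

open Polynomial in
/-- Over `ℝ`, Rolle's theorem shows that derivatives of split polynomials split. -/
theorem splits_derivative_real {p : ℝ[X]} (hp : p.Splits) : (derivative p).Splits := by
  rw [splits_iff_card_roots] at hp ⊢
  have h1 := card_roots_le_derivative p
  have h2 := natDegree_derivative_le p
  have h3 := card_roots' (derivative p)
  omega

open Polynomial in
/-- The Laguerre inequality for real polynomials all of whose roots are real. -/
theorem laguerre_inequality {p : ℝ[X]} (hp : p.Splits) (t : ℝ) :
    p.eval t * (derivative (derivative p)).eval t ≤ (derivative p).eval t ^ 2 := by
  obtain ⟨m, hm⟩ := splits_iff_exists_multiset.mp hp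
  rw [hm]
  clear hm
  generalize p.leadingCoeff = c
  induction m using Multiset.induction with
  | empty => simp
  | cons a m ih =>
    rw [Multiset.map_cons, Multiset.prod_cons, mul_left_comm]
    generalize C c * (m.map fun a => X - C a).prod = q at ih
    simp only [derivative_mul, derivative_add, derivative_sub, derivative_X, derivative_C,
      eval_mul, eval_add, eval_sub, eval_X, eval_C, sub_zero, one_mul]
    nlinarith [mul_le_mul_of_nonneg_left ih (sq_nonneg (t - a)), sq_nonneg (q.eval t)]

section FinsetEsymm

variable {ι : Type*}

/-- The `k`-th elementary symmetric polynomial in the variables indexed by a finset `s`. -/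
noncomputable def finsetEsymm (s : Finset ι) (k : ℕ) (x : ι → ℝ) : ℝ :=
  ∑ t ∈ s.powersetCard k, ∏ i ∈ t, x i

/-- The vectors whose first `k` elementary symmetric polynomials over `s` are positive. -/
def finsetGamma (s : Finset ι) (k : ℕ) : Set (ι → ℝ) :=
  {x | ∀ j ≤ k, 0 < finsetEsymm s j x}

theorem finsetGamma_anti (s : Finset ι) {k l : ℕ} (h : k ≤ l) :
    finsetGamma s l ⊆ finsetGamma s k := fun _ hx j hj => hx j (hj.trans h)

@[simp]
theorem finsetEsymm_zero (s : Finset ι) (x : ι → ℝ) : finsetEsymm s 0 x = 1 := by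
  simp [finsetEsymm]

theorem finsetEsymm_one (s : Finset ι) (x : ι → ℝ) : finsetEsymm s 1 x = ∑ i ∈ s, x i := by
  simp [finsetEsymm, Finset.powersetCard_one]

theorem finsetEsymm_empty_succ (k : ℕ) (x : ι → ℝ) :
    finsetEsymm (∅ : Finset ι) (k + 1) x = 0 := by
  rw [finsetEsymm, Finset.powersetCard_eq_empty.2 (by simp), Finset.sum_empty]

theorem finsetEsymm_smul (s : Finset ι) (k : ℕ) (c : ℝ) (x : ι → ℝ) :
    finsetEsymm s k (c • x) = c ^ k * finsetEsymm s k x := by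
  simp only [finsetEsymm, Finset.mul_sum, Pi.smul_apply, smul_eq_mul]
  refine Finset.sum_congr rfl fun t ht => ?_
  rw [Finset.prod_mul_distrib, Finset.prod_const, (Finset.mem_powersetCard.1 ht).2]

theorem smul_mem_finsetGamma {s : Finset ι} {k : ℕ} {x : ι → ℝ} (hx : x ∈ finsetGamma s k)
    {c : ℝ} (hc : 0 < c) : c • x ∈ finsetGamma s k := fun j hj => by
  rw [finsetEsymm_smul]
  exact mul_pos (pow_pos hc j) (hx j hj)

/-- A weak form of Newton's inequality. -/
theorem finsetEsymm_mul_le_sq (s : Finset ι) (k : ℕ) (x : ι → ℝ) :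
    finsetEsymm s k x * finsetEsymm s (k + 2) x ≤ finsetEsymm s (k + 1) x ^ 2 := by
  open Polynomial in
  by_cases hk : k + 2 ≤ s.card
  · obtain ⟨r, hr⟩ := Nat.exists_eq_add_of_le hk
    set p : ℝ[X] := ∏ i ∈ s, (X + C (x i)) with hp
    have hps : p.Splits := Splits.prod fun i _ => Splits.X_add_C _
    have hds : ∀ m, (derivative^[m] p).Splits := fun m => by
      induction m with
      | zero => exact hps
      | succ m ih =>
        rw [Function.iterate_succ_apply']
        exact splits_derivative_real ih
    have hcoeff : ∀ m, m ≤ s.card → p.coeff m = finsetEsymm s (s.card - m) x := fun m hm =>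
      Finset.prod_X_add_C_coeff s x hm
    have heval : ∀ m, (derivative^[m] p).eval 0 = m.factorial * p.coeff m := fun m => by
      rw [← coeff_zero_eq_eval_zero, coeff_iterate_derivative]
      simp [Nat.descFactorial_self]
    have hL := laguerre_inequality (hds r) 0
    rw [← Function.iterate_succ_apply' derivative, ← Function.iterate_succ_apply' derivative,
      heval, heval, heval, hcoeff _ (by omega), hcoeff _ (by omega), hcoeff _ (by omega)] at hL
    rw [show s.card - r = k + 2 by omega, show s.card - r.succ = k + 1 by omega,
      show s.card - r.succ.succ = k by omega] at hL
    by_cases hneg : finsetEsymm s k x * finsetEsymm s (k + 2) x ≤ 0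
    · exact hneg.trans (sq_nonneg _)
    · push Not at hneg
      simp only [Nat.factorial_succ, Nat.succ_eq_add_one] at hL
      push_cast at hL
      have hr0 : (0 : ℝ) < r.factorial := by positivity
      have h1 : (0 : ℝ) < (r.factorial * ((r : ℝ) + 1)) ^ 2 := by positivity
      refine le_of_mul_le_mul_left ?_ h1
      have h2 : 0 ≤ (r.factorial : ℝ) ^ 2 * ((r : ℝ) + 1) *
        (finsetEsymm s k x * finsetEsymm s (k + 2) x) := by positivity
      nlinarith
  · rw [finsetEsymm, finsetEsymm, Finset.powersetCard_eq_empty.2 (by omega : s.card < k + 2)]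
    simp [sq_nonneg]

theorem contDiff_finsetEsymm [Fintype ι] (s : Finset ι) (k : ℕ) {m : WithTop ℕ∞} :
    ContDiff ℝ m (finsetEsymm s k) := by
  unfold finsetEsymm
  fun_prop

variable [DecidableEq ι]

theorem finsetEsymm_insert {s : Finset ι} {a : ι} (ha : a ∉ s) (k : ℕ) (x : ι → ℝ) :
    finsetEsymm (insert a s) (k + 1) x = finsetEsymm s (k + 1) x + x a * finsetEsymm s k x := by
  have hmem : ∀ n, ∀ t ∈ s.powersetCard n, a ∉ t := fun n t ht h =>
    ha ((Finset.mem_powersetCard.1 ht).1 h)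
  rw [finsetEsymm, Finset.powersetCard_succ_insert ha, Finset.sum_union, Finset.sum_image,
    finsetEsymm, finsetEsymm, Finset.mul_sum]
  · congr 1
    exact Finset.sum_congr rfl fun t ht => Finset.prod_insert (hmem k t ht)
  · intro t ht u hu htu
    rw [← Finset.erase_insert (hmem k t ht), ← Finset.erase_insert (hmem k u hu), htu]
  · rw [Finset.disjoint_left]
    intro t ht ht'
    obtain ⟨u, _, rfl⟩ := Finset.mem_image.1 ht'
    exact hmem _ _ ht (Finset.mem_insert_self a u)

theorem finsetEsymm_erase {s : Finset ι} {a : ι} (ha : a ∈ s) (k : ℕ) (x : ι → ℝ) :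
    finsetEsymm s (k + 1) x =
      finsetEsymm (s.erase a) (k + 1) x + x a * finsetEsymm (s.erase a) k x := by
  conv_lhs => rw [← Finset.insert_erase ha]
  exact finsetEsymm_insert (Finset.notMem_erase a s) k x

/-- Removing one variable maps the cone `Γ_{k+1}` into `Γ_k`. -/
theorem finsetGamma_erase {s : Finset ι} {a : ι} (ha : a ∈ s) {k : ℕ} {x : ι → ℝ}
    (hx : x ∈ finsetGamma s (k + 1)) : x ∈ finsetGamma (s.erase a) k := by
  intro j
  induction j with
  | zero => simp
  | succ j ih =>
    intro hj
    have h0 := ih (by omega)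
    have h1 := hx (j + 1) (by omega)
    have h2 := hx (j + 2) (by omega)
    have hN := finsetEsymm_mul_le_sq (s.erase a) j x
    rw [finsetEsymm_erase ha] at h1 h2
    by_contra! hneg
    generalize finsetEsymm (s.erase a) j x = p at *
    generalize finsetEsymm (s.erase a) (j + 1) x = q at *
    generalize finsetEsymm (s.erase a) (j + 2) x = r at *
    have hxa : 0 < x a := pos_of_mul_pos_left (by linarith : 0 < x a * p) h0.le
    nlinarith [mul_nonneg_of_nonpos_of_nonpos hneg hneg, mul_le_mul_of_nonneg_left hN hxa.le,
      mul_pos (mul_pos hxa h0) h2, mul_nonneg (neg_nonneg.2 hneg) h1.le]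

/-- Euler's identity for elementary symmetric polynomials. -/
theorem sum_mul_finsetEsymm_erase (s : Finset ι) (k : ℕ) (x : ι → ℝ) :
    ∑ i ∈ s, x i * finsetEsymm (s.erase i) k x = (k + 1) * finsetEsymm s (k + 1) x := by
  induction s using Finset.induction_on generalizing k with
  | empty => simp [finsetEsymm_empty_succ]
  | insert a s ha ih =>
    rw [Finset.sum_insert ha, Finset.erase_insert ha]
    have herase : ∀ i ∈ s, (insert a s).erase i = insert a (s.erase i) := fun i hi =>
      Finset.erase_insert_of_ne (by rintro rfl; exact ha hi)
    cases k with
    | zero => simp [finsetEsymm_one, Finset.sum_insert ha]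
    | succ k =>
      have hsum : ∑ i ∈ s, x i * finsetEsymm ((insert a s).erase i) (k + 1) x =
          ∑ i ∈ s, x i * finsetEsymm (s.erase i) (k + 1) x +
            x a * ∑ i ∈ s, x i * finsetEsymm (s.erase i) k x := by
        rw [Finset.mul_sum, ← Finset.sum_add_distrib]
        refine Finset.sum_congr rfl fun i hi => ?_
        rw [herase i hi, finsetEsymm_insert (fun h => ha (Finset.mem_of_mem_erase h))]
        ring
      rw [hsum, ih, ih, finsetEsymm_insert ha]
      push_cast
      ring

theorem hasFDerivAt_finsetEsymm [Fintype ι] (s : Finset ι) (k : ℕ) (x : ι → ℝ) :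
    HasFDerivAt (finsetEsymm s (k + 1))
      (∑ i ∈ s, finsetEsymm (s.erase i) k x • ContinuousLinearMap.proj (R := ℝ) (φ := fun _ : ι => ℝ) i) x := by
  induction s using Finset.induction_on generalizing k with
  | empty =>
    rw [show finsetEsymm (∅ : Finset ι) (k + 1) = fun _ => 0 from
      funext (finsetEsymm_empty_succ k)]
    simpa using hasFDerivAt_const (0 : ℝ) x
  | insert a s ha ih =>
    rw [show finsetEsymm (insert a s) (k + 1) =
      fun y => finsetEsymm s (k + 1) y + y a * finsetEsymm s k y from
        funext (finsetEsymm_insert ha k)]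
    have hproj : HasFDerivAt (fun y : ι → ℝ => y a) (ContinuousLinearMap.proj (R := ℝ) a) x :=
      hasFDerivAt_apply a x
    have herase : ∀ i ∈ s, (insert a s).erase i = insert a (s.erase i) := fun i hi =>
      Finset.erase_insert_of_ne (by rintro rfl; exact ha hi)
    rw [Finset.sum_insert ha, Finset.erase_insert ha]
    cases k with
    | zero => simpa [add_comm] using hproj.fun_add (ih 0)
    | succ k =>
      refine ((ih (k + 1)).add (hproj.mul (ih k))).congr_fderiv ?_
      rw [← add_assoc, add_comm, Finset.smul_sum, ← Finset.sum_add_distrib]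
      congr 1
      refine Finset.sum_congr rfl fun i hi => ?_
      rw [herase i hi, finsetEsymm_insert (fun h => ha (Finset.mem_of_mem_erase h)), add_smul,
        mul_smul]

/-- Superadditivity of the harmonic-type mean `a q / (a + q)`, combined with its monotonicity
in `q`. -/
theorem parallel_sum_superadditive {a b p q r : ℝ} (ha : 0 < a + p) (hb : 0 < b + q)
    (hr : p + q ≤ r) :
    a * p / (a + p) + b * q / (b + q) ≤ (a + b) * r / (a + b + r) := by
  have hc : 0 < a + b + r := by linarith
  rw [div_add_div _ _ ha.ne' hb.ne', div_le_div_iff₀ (mul_pos ha hb) hc]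
  obtain ⟨d, rfl⟩ : ∃ d, r = p + q + d := ⟨r - p - q, by ring⟩
  have hd : 0 ≤ d := by linarith
  have key : (a + b) * (p + q + d) * ((a + p) * (b + q)) -
      (a * p * (b + q) + (a + p) * (b * q)) * (a + b + (p + q + d)) =
      (a * q - b * p) ^ 2 + d * (a ^ 2 * (b + q) + b ^ 2 * (a + p)) := by ring
  have : 0 ≤ d * (a ^ 2 * (b + q) + b ^ 2 * (a + p)) := by positivity
  nlinarith [sq_nonneg (a * q - b * p)]

theorem finsetEsymm_div_eq {s : Finset ι} {k : ℕ} {x : ι → ℝ}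
    (hx : x ∈ finsetGamma s (k + 1)) :
    (k + 2) * (finsetEsymm s (k + 2) x / finsetEsymm s (k + 1) x) =
      ∑ i ∈ s, x i * (finsetEsymm (s.erase i) (k + 1) x / finsetEsymm (s.erase i) k x) /
        (x i + finsetEsymm (s.erase i) (k + 1) x / finsetEsymm (s.erase i) k x) := by
  have h := sum_mul_finsetEsymm_erase s (k + 1) x
  rw [← mul_div_assoc, show ((k : ℝ) + 2) = ((k + 1 : ℕ) : ℝ) + 1 by push_cast; ring, ← h,
    Finset.sum_div]
  refine Finset.sum_congr rfl fun i hi => ?_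
  have h0 := finsetGamma_erase hi hx k le_rfl
  have h1 := hx (k + 1) le_rfl
  rw [finsetEsymm_erase hi] at h1 ⊢
  rw [mul_div_assoc', div_div, mul_add, mul_div_cancel₀ _ h0.ne', add_comm (finsetEsymm _ (k + 1) _),
    mul_comm (x i) (finsetEsymm _ k _)]

/-- Marcus–Lopes: the quotient `σ_{k+1} / σ_k` is superadditive on `Γ_{k+1}`. -/
theorem finsetEsymm_div_superadditive (k : ℕ) (s : Finset ι) {x y : ι → ℝ}
    (hx : x ∈ finsetGamma s (k + 1)) (hy : y ∈ finsetGamma s (k + 1)) :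
    x + y ∈ finsetGamma s (k + 1) ∧
      finsetEsymm s (k + 1) x / finsetEsymm s k x + finsetEsymm s (k + 1) y / finsetEsymm s k y ≤
        finsetEsymm s (k + 1) (x + y) / finsetEsymm s k (x + y) := by
  induction k generalizing s with
  | zero =>
    have hadd : finsetEsymm s 1 (x + y) = finsetEsymm s 1 x + finsetEsymm s 1 y := by
      simp [finsetEsymm_one, Finset.sum_add_distrib]
    have h1 := hx 1 le_rfl
    have h2 := hy 1 le_rfl
    refine ⟨fun j hj => ?_, by simp [hadd]⟩
    interval_cases j
    · simp
    · rw [hadd]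
      exact add_pos h1 h2
  | succ k ih =>
    have hx' := finsetGamma_anti s (Nat.le_succ (k + 1)) hx
    have hy' := finsetGamma_anti s (Nat.le_succ (k + 1)) hy
    obtain ⟨hxy, -⟩ := ih s hx' hy'
    have hpos : ∀ z ∈ finsetGamma s (k + 1), ∀ i ∈ s,
        0 < z i + finsetEsymm (s.erase i) (k + 1) z / finsetEsymm (s.erase i) k z := by
      intro z hz i hi
      have h0 := finsetGamma_erase hi hz k le_rfl
      have h1 := hz (k + 1) le_rfl
      rw [finsetEsymm_erase hi] at h1
      rw [← mul_div_cancel_right₀ (z i) h0.ne', ← add_div, add_comm]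
      exact div_pos h1 h0
    have hle : finsetEsymm s (k + 2) x / finsetEsymm s (k + 1) x +
        finsetEsymm s (k + 2) y / finsetEsymm s (k + 1) y ≤
        finsetEsymm s (k + 2) (x + y) / finsetEsymm s (k + 1) (x + y) := by
      refine le_of_mul_le_mul_left ?_ (by positivity : (0 : ℝ) < k + 2)
      rw [mul_add, finsetEsymm_div_eq hx', finsetEsymm_div_eq hy', finsetEsymm_div_eq hxy,
        ← Finset.sum_add_distrib]
      exact Finset.sum_le_sum fun i hi => parallel_sum_superadditive (hpos x hx' i hi)
        (hpos y hy' i hi) (ih _ (finsetGamma_erase hi hx) (finsetGamma_erase hi hy)).2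
    refine ⟨fun j hj => ?_, hle⟩
    rcases Nat.lt_or_eq_of_le hj with hj | rfl
    · exact hxy j (by omega)
    · have h1 := div_pos (hx (k + 2) le_rfl) (hx' (k + 1) le_rfl)
      have h2 := div_pos (hy (k + 2) le_rfl) (hy' (k + 1) le_rfl)
      exact (div_pos_iff_of_pos_right (hxy (k + 1) le_rfl)).1 ((add_pos h1 h2).trans_le hle)

theorem convex_finsetGamma (s : Finset ι) (k : ℕ) : Convex ℝ (finsetGamma s k) := by
  rw [convex_iff_forall_pos]
  intro x hx y hy a b ha hb _
  cases k with
  | zero => exact fun j hj => by simp [Nat.le_zero.1 hj]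
  | succ k =>
    exact (finsetEsymm_div_superadditive k s (smul_mem_finsetGamma hx ha)
      (smul_mem_finsetGamma hy hb)).1

theorem concaveOn_log_finsetEsymm_div (s : Finset ι) (k : ℕ) :
    ConcaveOn ℝ (finsetGamma s (k + 1))
      (fun x => Real.log (finsetEsymm s (k + 1) x / finsetEsymm s k x)) := by
  rw [concaveOn_iff_forall_pos]
  refine ⟨convex_finsetGamma s (k + 1), fun x hx y hy a b ha hb hab => ?_⟩
  have hquot : ∀ z ∈ finsetGamma s (k + 1), ∀ c : ℝ, 0 < c →
      finsetEsymm s (k + 1) (c • z) / finsetEsymm s k (c • z) =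
        c * (finsetEsymm s (k + 1) z / finsetEsymm s k z) := by
    intro z hz c hc
    have := hz k (Nat.le_succ k)
    rw [finsetEsymm_smul, finsetEsymm_smul]
    field_simp
    ring
  have hpos : ∀ z ∈ finsetGamma s (k + 1), 0 < finsetEsymm s (k + 1) z / finsetEsymm s k z :=
    fun z hz => div_pos (hz _ le_rfl) (hz _ (Nat.le_succ k))
  have hle := (finsetEsymm_div_superadditive k s (smul_mem_finsetGamma hx ha)
    (smul_mem_finsetGamma hy hb)).2
  rw [hquot x hx a ha, hquot y hy b hb] at hle
  refine (strictConcaveOn_log_Ioi.concaveOn.2 (hpos x hx) (hpos y hy) ha.le hb.le hab).trans ?_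
  exact Real.log_le_log (add_pos (mul_pos ha (hpos x hx)) (mul_pos hb (hpos y hy))) hle

theorem concaveOn_log_finsetEsymm (s : Finset ι) (k : ℕ) :
    ConcaveOn ℝ (finsetGamma s k) (fun x => Real.log (finsetEsymm s k x)) := by
  induction k with
  | zero => simpa using concaveOn_const (0 : ℝ) (convex_finsetGamma s 0)
  | succ k ih =>
    refine ((ih.subset (finsetGamma_anti s (Nat.le_succ k)) (convex_finsetGamma s (k + 1))).add
      (concaveOn_log_finsetEsymm_div s k)).congr fun x hx => ?_
    have h1 := hx k (Nat.le_succ k)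
    have h2 := hx (k + 1) le_rfl
    simp only [Pi.add_apply]
    rw [Real.log_div h2.ne' h1.ne']
    ring

end FinsetEsymm

theorem finsetEsymm_univ (n k : ℕ) : finsetEsymm Finset.univ k = esymm n k := rfl

theorem gammaCone_eq_finsetGamma (n k : ℕ) : gammaCone n k = finsetGamma Finset.univ k := by
  ext x
  refine ⟨fun hx j hj => ?_, fun hx j _ hj => hx j hj⟩
  rcases Nat.eq_zero_or_pos j with rfl | h
  · simp
  · exact hx j h hj

theorem esymm_comp_perm (n k : ℕ) (π : Equiv.Perm (Fin n)) (x : Fin n → ℝ) :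
    esymm n k (x ∘ π) = esymm n k x := by
  rw [esymm, esymm, ← Finset.esymm_map_val, ← Finset.esymm_map_val, ← Multiset.map_map]
  congr 2
  exact congrArg Finset.val (Finset.map_univ_equiv π)

theorem TT_comp_perm (n : ℕ) (π : Equiv.Perm (Fin n)) (x : Fin n → ℝ) :
    TT n (x ∘ π) = TT n x ∘ π := by
  ext i
  simp [TT, Equiv.sum_comp π x]

/-- The map `TT n` as a continuous linear map. -/
noncomputable def continuousLinearTT (n : ℕ) : (Fin n → ℝ) →L[ℝ] (Fin n → ℝ) :=
  ContinuousLinearMap.pi fun i =>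
    (∑ j, ContinuousLinearMap.proj (R := ℝ) j) - ContinuousLinearMap.proj i

theorem coe_continuousLinearTT (n : ℕ) : ⇑(continuousLinearTT n) = TT n := by
  ext x i
  simp [continuousLinearTT, TT]

theorem TT_pos {n : ℕ} (hn : 2 ≤ n) {x : Fin n → ℝ} (hx : ∀ i, 0 < x i) (i : Fin n) :
    0 < TT n x i := by
  have : Nontrivial (Fin n) := Fin.nontrivial_iff_two_le.2 hn
  obtain ⟨j, hj⟩ := exists_ne i
  exact sub_pos.2 (Finset.single_lt_sum hj (Finset.mem_univ i) (Finset.mem_univ j) (hx j)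
    fun l _ _ => (hx l).le)

/-- Let `n ≥ 2` and `1 ≤ k ≤ n`, and let `Γ := 𝐓⁻¹(Γ_k)` where
`Tᵢ(λ) = Σ_{j≠i} λⱼ`.  Then `Γ` is an open convex cone with vertex at the origin, symmetric
under permutations of coordinates, containing the positive orthant `Γₙ`; and
`f(λ) = log σ_k(𝐓(λ))` is smooth and concave on `Γ` with positive partial derivatives on
`Γ`. -/
theorem stmt_15 (n k : ℕ) (hn : 2 ≤ n) (hk1 : 1 ≤ k) (hk : k ≤ n) :
    IsOpen (TT n ⁻¹' gammaCone n k) ∧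
    Convex ℝ (TT n ⁻¹' gammaCone n k) ∧
    (∀ x ∈ TT n ⁻¹' gammaCone n k, ∀ t : ℝ, 0 < t → t • x ∈ TT n ⁻¹' gammaCone n k) ∧
    (∀ π : Equiv.Perm (Fin n), ∀ x ∈ TT n ⁻¹' gammaCone n k,
      (x ∘ π) ∈ TT n ⁻¹' gammaCone n k) ∧
    {x : Fin n → ℝ | ∀ i, 0 < x i} ⊆ TT n ⁻¹' gammaCone n k ∧
    ContDiffOn ℝ (⊤ : ℕ∞) (fun x : Fin n → ℝ => Real.log (esymm n k (TT n x)))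
      (TT n ⁻¹' gammaCone n k) ∧
    ConcaveOn ℝ (TT n ⁻¹' gammaCone n k)
      (fun x : Fin n → ℝ => Real.log (esymm n k (TT n x))) ∧
    ∀ x ∈ TT n ⁻¹' gammaCone n k, ∀ i : Fin n,
      0 < fderiv ℝ (fun x : Fin n → ℝ => Real.log (esymm n k (TT n x))) x
        (Pi.single i 1) := by
  have hT : ContDiff ℝ (⊤ : ℕ∞) (TT n) := by
    rw [← coe_continuousLinearTT]
    exact (continuousLinearTT n).contDiff
  have hE : ∀ j, ContDiff ℝ (⊤ : ℕ∞) (fun x => esymm n j (TT n x)) := fun j =>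
    (contDiff_finsetEsymm Finset.univ j).comp hT
  have hpos : ∀ x ∈ TT n ⁻¹' gammaCone n k, 0 < esymm n k (TT n x) := fun x hx => hx k hk1 le_rfl
  have hconc : ConcaveOn ℝ (TT n ⁻¹' gammaCone n k)
      (fun x : Fin n → ℝ => Real.log (esymm n k (TT n x))) := by
    rw [gammaCone_eq_finsetGamma, ← coe_continuousLinearTT]
    exact (concaveOn_log_finsetEsymm Finset.univ k).comp_linearMap
      (continuousLinearTT n : (Fin n → ℝ) →ₗ[ℝ] (Fin n → ℝ))
  refine ⟨?_, hconc.1, ?_, ?_, ?_, ?_, hconc, ?_⟩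
  · have : TT n ⁻¹' gammaCone n k =
        ⋂ j ∈ Set.Icc 1 k, (fun x => esymm n j (TT n x)) ⁻¹' Set.Ioi 0 := by
      ext x
      simp [gammaCone]
    rw [this]
    exact (Set.finite_Icc 1 k).isOpen_biInter fun j _ => isOpen_Ioi.preimage (hE j).continuous
  · intro x hx t ht
    rw [gammaCone_eq_finsetGamma, ← coe_continuousLinearTT] at *
    rw [Set.mem_preimage, map_smul]
    exact smul_mem_finsetGamma hx ht
  · intro π x hx j hj1 hj
    rw [TT_comp_perm, esymm_comp_perm]
    exact hx j hj1 hj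
  · intro x hx j _ hj
    refine Finset.sum_pos (fun t _ => Finset.prod_pos fun i _ => TT_pos hn hx i) ?_
    exact Finset.powersetCard_nonempty.2 (by simpa using hj.trans hk)
  · exact (hE k).contDiffOn.log fun x hx => (hpos x hx).ne'
  · intro x hx i
    obtain ⟨m, rfl⟩ : ∃ m, k = m + 1 := ⟨k - 1, by omega⟩
    have hlin : HasFDerivAt (TT n) (continuousLinearTT n) x := by
      rw [← coe_continuousLinearTT]
      exact (continuousLinearTT n).hasFDerivAt
    have hd := ((hasFDerivAt_finsetEsymm Finset.univ m (TT n x)).comp x hlin).log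
      (hpos x hx).ne'
    have hfd := hd.fderiv
    simp only [Function.comp_def, finsetEsymm_univ] at hfd
    rw [hfd, smul_apply, ContinuousLinearMap.comp_apply,
      coe_continuousLinearTT, sum_apply, smul_eq_mul]
    refine mul_pos (inv_pos.2 (hpos x hx)) ?_
    have : Nontrivial (Fin n) := Fin.nontrivial_iff_two_le.2 hn
    obtain ⟨j, hj⟩ := exists_ne i
    have hcone : TT n x ∈ finsetGamma Finset.univ (m + 1) := gammaCone_eq_finsetGamma n _ ▸ hx
    have hcoef : ∀ l, 0 < finsetEsymm (Finset.univ.erase l) m (TT n x) := fun l =>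
      finsetGamma_erase (Finset.mem_univ l) hcone m le_rfl
    have hsingle : ∀ l, TT n (Pi.single i 1) l = if l = i then 0 else 1 := fun l => by
      by_cases h : l = i <;> simp [TT, Pi.single_apply, h]
    refine Finset.sum_pos' (fun l _ => ?_) ⟨j, Finset.mem_univ j, ?_⟩
    · rw [smul_apply, ContinuousLinearMap.proj_apply, hsingle, smul_eq_mul]
      exact mul_nonneg (hcoef l).le (by split_ifs <;> norm_num)
    · rw [smul_apply, ContinuousLinearMap.proj_apply, hsingle, smul_eq_mul,
        if_neg hj, mul_one]
      exact hcoef j
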